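/- Let ζ be a parabolic periodic point of f_c of period m ≥ 1, and let z ∈ ℂ be such that dist(f_c^[n](z), {ζ, f_c(ζ), …, f_c^[m−1](ζ)}) → 0 as n → ∞. Then (z,c) ∈ 𝕁; equivalently, for every δ > 0 there exist z̃, c̃ ∈ ℂ with |z − z̃| < δ, |c − c̃| < δ and z̃ ∈ J_{c̃}. -/

import Mathlib

open Filter Metric Topology

noncomputable section

/-- The quadratic polynomial `f_c(z) = z² + c`. -/
def f (c : ℂ) : ℂ → ℂ := fun z => z ^ 2 + c

/-- The filled Julia set `K_c`: points with bounded forward orbit. -/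
def K (c : ℂ) : Set ℂ := {z : ℂ | Bornology.IsBounded (Set.range fun n => (f c)^[n] z)}

/-- The Julia set `J_c`: the boundary of the filled Julia set. -/
def J (c : ℂ) : Set ℂ := frontier (K c)

/-- The set `𝕁`: the closure in `ℂ × ℂ` of `{(z,c) : z ∈ J_c}`. -/
def bbJ : Set (ℂ × ℂ) := closure {p : ℂ × ℂ | p.1 ∈ J p.2}

/-- A complex number is a root of unity. -/
def IsRootOfUnity (u : ℂ) : Prop := ∃ n : ℕ, 1 ≤ n ∧ u ^ n = 1

theorem iterate_f_succ (c z : ℂ) (n : ℕ) : (f c)^[n + 1] z = ((f c)^[n] z) ^ 2 + c := by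
  rw [Function.iterate_succ_apply']; rfl

/-- The derivative of `(f c)^[n]` at `z`, as given by the chain rule. -/
def orbitDeriv (c : ℂ) (n : ℕ) (z : ℂ) : ℂ := ∏ i ∈ Finset.range n, 2 * (f c)^[i] z

theorem hasDerivAt_iterate_f (c : ℂ) (n : ℕ) (z : ℂ) :
    HasDerivAt ((f c)^[n]) (orbitDeriv c n z) z := by
  induction n with
  | zero => simpa [orbitDeriv] using! hasDerivAt_id z
  | succ n ih =>
    have h : (f c)^[n + 1] = fun w => ((f c)^[n] w) ^ 2 + c :=
      funext fun w => iterate_f_succ c w n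
    rw [h, orbitDeriv, Finset.prod_range_succ, ← orbitDeriv]
    convert! (ih.pow 2).add_const c using 1
    push_cast
    ring

theorem orbitDeriv_add (c : ℂ) (a b : ℕ) (z : ℂ) :
    orbitDeriv c (a + b) z = orbitDeriv c a z * orbitDeriv c b ((f c)^[a] z) := by
  simp only [orbitDeriv, Finset.prod_range_add, ← Function.iterate_add_apply, add_comm]

theorem iterate_mul_fixed {c p : ℂ} {k : ℕ} (hp : (f c)^[k] p = p) (j : ℕ) :
    (f c)^[k * j] p = p := by
  rw [Function.iterate_mul]
  exact Function.iterate_fixed hp j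

theorem orbitDeriv_mul {c p : ℂ} {k : ℕ} (hp : (f c)^[k] p = p) (j : ℕ) :
    orbitDeriv c (k * j) p = orbitDeriv c k p ^ j := by
  induction j with
  | zero => simp [orbitDeriv]
  | succ j ih => rw [mul_add, mul_one, orbitDeriv_add, iterate_mul_fixed hp, ih, pow_succ]

theorem orbitDeriv_cycle {c p : ℂ} {k i : ℕ} (hp : (f c)^[k] p = p)
    (h0 : orbitDeriv c i p ≠ 0) :
    orbitDeriv c k ((f c)^[i] p) = orbitDeriv c k p := by
  have h1 := orbitDeriv_add c i k p
  rw [add_comm, orbitDeriv_add, hp, mul_comm] at h1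
  exact (mul_left_cancel₀ h0 h1).symm

theorem orbitDeriv_ne_zero_of_le {c p : ℂ} {i k : ℕ} (hik : i ≤ k) (h : orbitDeriv c k p ≠ 0) :
    orbitDeriv c i p ≠ 0 := by
  obtain ⟨j, rfl⟩ := Nat.exists_eq_add_of_le hik
  rw [orbitDeriv_add] at h
  exact left_ne_zero_of_mul h

theorem iterate_f_sub_iterate_f (c x y : ℂ) (n : ℕ) :
    (f c)^[n] x - (f c)^[n] y =
      (x - y) * ∏ i ∈ Finset.range n, ((f c)^[i] x + (f c)^[i] y) := by
  induction n with
  | zero => simp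
  | succ n ih =>
    rw [Finset.prod_range_succ, ← mul_assoc, ← ih, iterate_f_succ, iterate_f_succ]
    ring

theorem differentiableOn_iterate_f {s : Set ℂ} {g : ℂ → ℂ} (hg : DifferentiableOn ℂ g s) (n : ℕ) :
    DifferentiableOn ℂ (fun x => (f x)^[n] (g x)) s := by
  induction n with
  | zero => simpa using hg
  | succ n ih =>
    simp only [iterate_f_succ]
    exact (ih.pow 2).add differentiableOn_id

theorem continuous_iterate_f (c : ℂ) (n : ℕ) : Continuous ((f c)^[n]) :=
  Continuous.iterate (by unfold f; fun_prop) n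

theorem iterate_f_growth {c w : ℂ} (hw : ‖c‖ + 2 < ‖w‖) (n : ℕ) :
    ‖c‖ + 2 < ‖(f c)^[n] w‖ ∧ 2 * (‖w‖ / 2) ^ 2 ^ n ≤ ‖(f c)^[n] w‖ := by
  induction n with
  | zero => exact ⟨by simpa using hw, by simp; linarith⟩
  | succ n ih =>
    obtain ⟨h1, h2⟩ := ih
    set x := (f c)^[n] w
    have h3 : ‖x‖ ^ 2 - ‖c‖ ≤ ‖(f c)^[n + 1] w‖ := by
      rw [iterate_f_succ]
      have := norm_sub_le_norm_add (x ^ 2) c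
      rwa [norm_pow] at this
    have hc := norm_nonneg c
    refine ⟨by nlinarith, ?_⟩
    have h4 : (2 * (‖w‖ / 2) ^ 2 ^ n) ^ 2 ≤ ‖x‖ ^ 2 := by gcongr
    rw [pow_succ 2 n, pow_mul]
    nlinarith

theorem mem_K_iff_isBounded {c w : ℂ} :
    w ∈ K c ↔ Bornology.IsBounded (Set.range fun n => (f c)^[n] w) := by
  rw [K, Set.mem_ofPred_eq]

theorem norm_le_of_mem_K {c w : ℂ} (hw : w ∈ K c) : ‖w‖ ≤ ‖c‖ + 2 := by
  by_contra! h
  obtain ⟨B, hB⟩ := (mem_K_iff_isBounded.1 hw).exists_norm_le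
  have hρ : 1 < ‖w‖ / 2 := by linarith [norm_nonneg c]
  obtain ⟨n, hn⟩ := pow_unbounded_of_one_lt B hρ
  have h1 := (iterate_f_growth h n).2
  have h2 := hB _ ⟨n, rfl⟩
  have h3 : (‖w‖ / 2) ^ n ≤ (‖w‖ / 2) ^ 2 ^ n := pow_le_pow_right₀ hρ.le Nat.lt_two_pow_self.le
  have h4 : 0 < (‖w‖ / 2) ^ n := by positivity
  simp only at h2
  linarith

theorem iterate_mem_K {c w : ℂ} (hw : w ∈ K c) (n : ℕ) : (f c)^[n] w ∈ K c := by
  refine mem_K_iff_isBounded.2 ((mem_K_iff_isBounded.1 hw).subset ?_)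
  rintro _ ⟨k, rfl⟩
  exact ⟨k + n, by simp [Function.iterate_add_apply]⟩

theorem mem_K_of_forall_norm_le {c w : ℂ} {B : ℝ} (h : ∀ n, ‖(f c)^[n] w‖ ≤ B) : w ∈ K c :=
  mem_K_iff_isBounded.2 (isBounded_iff_forall_norm_le.2 ⟨B, by rintro _ ⟨n, rfl⟩; exact h n⟩)

theorem mem_K_iff {c w : ℂ} : w ∈ K c ↔ ∀ n, ‖(f c)^[n] w‖ ≤ ‖c‖ + 2 :=
  ⟨fun h n => norm_le_of_mem_K (iterate_mem_K h n), mem_K_of_forall_norm_le⟩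

theorem mem_K_of_iterate_mem_K {c w : ℂ} (n : ℕ) (h : (f c)^[n] w ∈ K c) : w ∈ K c := by
  by_contra hw
  rw [mem_K_iff] at hw
  push Not at hw
  obtain ⟨k, hk⟩ := hw
  have h1 := (iterate_f_growth hk n).1
  rw [← Function.iterate_add_apply, add_comm n k, Function.iterate_add_apply] at h1
  exact absurd (norm_le_of_mem_K (iterate_mem_K h k)) (not_le.2 h1)

theorem isClosed_K (c : ℂ) : IsClosed (K c) := by
  have : K c = ⋂ n, {w | ‖(f c)^[n] w‖ ≤ ‖c‖ + 2} := by
    ext w; simp [mem_K_iff]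
  rw [this]
  exact isClosed_iInter fun n => isClosed_le (continuous_iterate_f c n).norm continuous_const

theorem mem_J_iff {c w : ℂ} : w ∈ J c ↔ w ∈ K c ∧ w ∉ interior (K c) := by
  rw [J, (isClosed_K c).frontier_eq]; rfl

theorem isOpenMap_f (c : ℂ) : IsOpenMap (f c) := by
  have h : AnalyticOnNhd ℂ (f c) Set.univ := by
    intro x _
    unfold f
    fun_prop
  rcases h.is_constant_or_isOpen isPreconnected_univ with ⟨w, hw⟩ | h
  · have h0 := hw 0 trivial
    have h1 := hw 1 trivial
    simp only [f] at h0 h1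
    have : (1 : ℂ) = 0 := by linear_combination h1 - h0
    exact absurd this one_ne_zero
  · exact fun s hs => h s (Set.subset_univ s) hs

theorem isOpenMap_iterate_f (c : ℂ) (n : ℕ) : IsOpenMap ((f c)^[n]) := by
  induction n with
  | zero => exact IsOpenMap.id
  | succ n ih => rw [Function.iterate_succ']; exact (isOpenMap_f c).comp ih

theorem mem_J_of_iterate_mem_J {c w : ℂ} (n : ℕ) (h : (f c)^[n] w ∈ J c) : w ∈ J c := by
  rw [mem_J_iff] at h ⊢
  refine ⟨mem_K_of_iterate_mem_K n h.1, fun hw => h.2 ?_⟩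
  have h1 : IsOpen ((f c)^[n] '' interior (K c)) :=
    isOpenMap_iterate_f c n _ isOpen_interior
  refine interior_maximal ?_ h1 ⟨w, hw, rfl⟩
  rintro _ ⟨v, hv, rfl⟩
  exact iterate_mem_K (interior_subset hv) n

theorem ne_zero_of_one_lt_norm_orbitDeriv {c w : ℂ} {k : ℕ} (h : 1 < ‖orbitDeriv c k w‖) :
    1 ≤ k ∧ w ≠ 0 := by
  have hk : 1 ≤ k := by
    by_contra! hk
    obtain rfl : k = 0 := by omega
    simp [orbitDeriv] at h
  refine ⟨hk, ?_⟩
  rintro rfl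
  rw [orbitDeriv, Finset.prod_eq_zero (i := 0) (Finset.mem_range.2 hk) (by simp), norm_zero] at h
  linarith

theorem mem_J_of_repelling {c p : ℂ} {k : ℕ} (hp : (f c)^[k] p = p)
    (hrep : 1 < ‖orbitDeriv c k p‖) : p ∈ J c := by
  have hk := (ne_zero_of_one_lt_norm_orbitDeriv hrep).1
  rw [mem_J_iff]
  constructor
  · refine mem_K_iff_isBounded.2
      (((Finset.range k).finite_toSet.image fun i => (f c)^[i] p).isBounded.subset ?_)
    rintro _ ⟨n, rfl⟩
    refine ⟨n % k, by simpa using Nat.mod_lt n hk, ?_⟩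
    conv_rhs => rw [← Nat.mod_add_div n k]
    simp [Function.iterate_add_apply, iterate_mul_fixed hp]
  · intro hint
    obtain ⟨ε, hε, hball⟩ :=
      Metric.nhds_basis_closedBall.mem_iff.1 (mem_interior_iff_mem_nhds.1 hint)
    obtain ⟨j, hj⟩ := pow_unbounded_of_one_lt ((‖c‖ + 2) / ε) hrep
    have h1 : ‖deriv ((f c)^[k * j]) p‖ ≤ (‖c‖ + 2) / ε := by
      refine Complex.norm_deriv_le_of_forall_mem_sphere_norm_le hε ?_ fun w hw => ?_
      · exact (Differentiable.diffContOnCl fun w =>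
          (hasDerivAt_iterate_f c (k * j) w).differentiableAt)
      · exact mem_K_iff.1 (hball (sphere_subset_closedBall hw)) _
    rw [(hasDerivAt_iterate_f c _ p).deriv, orbitDeriv_mul hp, norm_pow] at h1
    linarith

theorem exists_isIntegral_mem_ball (c : ℂ) {r : ℝ} (hr : 0 < r) :
    ∃ x ∈ ball c r, IsIntegral ℤ x := by
  have hd : Dense (AddSubgroup.closure {√2, (1 : ℝ)} : Set ℝ) := by
    rw [dense_addSubgroupClosure_pair_iff, div_one]
    exact irrational_sqrt_two
  have hint : ∀ t ∈ AddSubgroup.closure {√2, (1 : ℝ)}, IsIntegral ℤ (t : ℂ) := by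
    intro t ht
    induction ht using AddSubgroup.closure_induction with
    | mem t ht =>
      rcases ht with rfl | rfl
      · refine IsIntegral.of_pow (n := 2) two_pos ?_
        rw [← Complex.ofReal_pow, Real.sq_sqrt (by norm_num)]
        exact isIntegral_algebraMap (R := ℤ) (x := 2)
      · simpa using isIntegral_one
    | zero => simp [isIntegral_zero]
    | add x y _ _ hx hy => simpa using hx.add hy
    | neg x _ hx => simpa using hx.neg
  obtain ⟨a, ha, hac⟩ := hd.exists_dist_lt c.re (half_pos hr)
  obtain ⟨b, hb, hbc⟩ := hd.exists_dist_lt c.im (half_pos hr)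
  refine ⟨a + b * Complex.I, ?_, (hint a ha).add ((hint b hb).mul Complex.isIntegral_int_I)⟩
  rw [mem_ball, dist_comm, dist_eq_norm]
  calc _ ≤ |(c - (a + b * Complex.I)).re| + |(c - (a + b * Complex.I)).im| :=
        Complex.norm_le_abs_re_add_abs_im _
    _ < r / 2 + r / 2 := by
      rw [Real.dist_eq] at hac hbc
      refine add_lt_add ?_ ?_
      · simpa using hac
      · simpa using hbc
    _ = r := add_halves r

theorem isIntegral_of_iterate_eq {c p : ℂ} (hc : IsIntegral ℤ c) {n : ℕ} (hn : 1 ≤ n)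
    (hp : (f c)^[n] p = p) : IsIntegral ℤ p := by
  let A := integralClosure ℤ ℂ
  let a : A := ⟨c, hc⟩
  have key : ∀ k : ℕ, ∃ P : Polynomial A, P.Monic ∧ P.natDegree = 2 ^ k ∧
      Polynomial.aeval p P = (f c)^[k] p := by
    intro k
    induction k with
    | zero => exact ⟨Polynomial.X, Polynomial.monic_X, by simp, by simp⟩
    | succ k ih =>
      obtain ⟨P, hP, hdeg, hev⟩ := ih
      have h2 : (P ^ 2).natDegree = 2 ^ (k + 1) := by rw [hP.natDegree_pow, hdeg]; ring
      have hlt : (Polynomial.C a).degree < (P ^ 2).degree := by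
        refine Polynomial.degree_C_le.trans_lt ?_
        rw [← Polynomial.natDegree_pos_iff_degree_pos, h2]
        positivity
      refine ⟨P ^ 2 + Polynomial.C a, (hP.pow 2).add_of_left hlt, ?_, ?_⟩
      · rw [Polynomial.natDegree_add_eq_left_of_degree_lt hlt, h2]
      · rw [iterate_f_succ, map_add, map_pow, hev, Polynomial.aeval_C]
        rfl
  obtain ⟨P, hP, hdeg, hev⟩ := key n
  have hA : IsIntegral A p := by
    refine ⟨P - Polynomial.X, hP.sub_of_left ?_, ?_⟩
    · rw [Polynomial.degree_X, Polynomial.degree_eq_natDegree hP.ne_zero, hdeg]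
      exact_mod_cast Nat.one_lt_two_pow (by omega)
    · rw [← Polynomial.aeval_def, map_sub, hev, hp, Polynomial.aeval_X, sub_self]
  exact isIntegral_trans (R := ℤ) (A := A) p hA

theorem orbitDeriv_ne_one_of_isIntegral {c p : ℂ} (hc : IsIntegral ℤ c) {n : ℕ} (hn : 1 ≤ n)
    (hp : (f c)^[n] p = p) : orbitDeriv c n p ≠ 1 := by
  intro h
  have hpi := isIntegral_of_iterate_eq hc hn hp
  have hi : ∀ k, IsIntegral ℤ ((f c)^[k] p) := by
    intro k
    induction k with
    | zero => simpa using hpi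
    | succ k ih => rw [iterate_f_succ]; exact (ih.pow 2).add hc
  have hhalf : IsIntegral ℤ (algebraMap ℚ ℂ (1 / 2)) := by
    obtain ⟨k, rfl⟩ := Nat.exists_eq_add_of_le' hn
    rw [orbitDeriv, Finset.prod_range_succ] at h
    have h2 : IsIntegral ℤ ((∏ i ∈ Finset.range k, 2 * (f c)^[i] p) * (f c)^[k] p) :=
      (IsIntegral.prod _ fun i _ => (isIntegral_algebraMap (R := ℤ) (x := 2)).mul (hi i)).mul (hi k)
    convert! h2 using 1
    rw [map_div₀, map_one, map_ofNat]
    linear_combination (-1 / 2 : ℂ) * h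
  rw [isIntegral_algebraMap_iff (algebraMap ℚ ℂ).injective] at hhalf
  obtain ⟨y, hy⟩ := IsIntegrallyClosed.isIntegral_iff.1 hhalf
  have h3 : (2 * y : ℚ) = 1 := by
    rw [eq_intCast] at hy
    rw [hy]; norm_num
  have h4 : 2 * y = 1 := by exact_mod_cast h3
  omega

/-- Near any parameter some repelling periodic point moves holomorphically. -/
theorem exists_repelling_continuation (c : ℂ) :
    ∃ (α : ℂ → ℂ) (k : ℕ) (r : ℝ), 0 < r ∧ DifferentiableOn ℂ α (ball c r) ∧
      ∀ x ∈ ball c r, (f x)^[k] (α x) = α x ∧ 1 < ‖orbitDeriv x k (α x)‖ := by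
  have hsqrt : ∀ g : ℂ → ℂ, Differentiable ℂ g → g c ≠ 0 → ∀ s₀ : ℂ, s₀ ^ 2 = g c →
      ∃ (s : ℂ → ℂ) (r : ℝ), 0 < r ∧ DifferentiableOn ℂ s (ball c r) ∧ s c = s₀ ∧
        ∀ x, s x ^ 2 = g x := by
    intro g hg h0 s₀ hs₀
    have hnhds : {x | g x / g c ∈ Complex.slitPlane} ∈ 𝓝 c := by
      refine (hg.continuous.div_const (g c)).continuousAt.preimage_mem_nhds
        (Complex.isOpen_slitPlane.mem_nhds ?_)
      rw [div_self h0]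
      exact Complex.one_mem_slitPlane
    obtain ⟨r, hr, hball⟩ := Metric.mem_nhds_iff.1 hnhds
    refine ⟨fun x => s₀ * (g x / g c) ^ (1 / 2 : ℂ), r, hr, ?_, by simp [div_self h0], ?_⟩
    · intro x hx
      exact (((hg x).div_const (g c)).cpow_const (hball hx)).differentiableWithinAt.const_mul s₀
    · intro x
      have : ((g x / g c) ^ (1 / 2 : ℂ)) ^ 2 = g x / g c := by
        simp
      rw [mul_pow, this, hs₀]
      field_simp
  have hshrink : ∀ (α : ℂ → ℂ) (k : ℕ) (r : ℝ), 0 < r → DifferentiableOn ℂ α (ball c r) →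
      (∀ x, (f x)^[k] (α x) = α x) → 1 < ‖orbitDeriv c k (α c)‖ →
      ∃ (α : ℂ → ℂ) (k : ℕ) (r : ℝ), 0 < r ∧ DifferentiableOn ℂ α (ball c r) ∧
      ∀ x ∈ ball c r, (f x)^[k] (α x) = α x ∧ 1 < ‖orbitDeriv x k (α x)‖ := by
    intro α k r hr hα hfix hrep
    have hd : DifferentiableOn ℂ (fun x => orbitDeriv x k (α x)) (ball c r) :=
      DifferentiableOn.fun_finsetProd fun i _ =>
        (differentiableOn_iterate_f hα i).const_mul 2
    have hcont : ContinuousAt (fun x => ‖orbitDeriv x k (α x)‖) c :=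
      (hd.continuousOn.continuousAt (ball_mem_nhds c hr)).norm
    obtain ⟨r', hr', h'⟩ := Metric.eventually_nhds_iff_ball.1 (hcont.eventually_const_lt hrep)
    exact ⟨α, k, min r r', lt_min hr hr', hα.mono (ball_subset_ball (min_le_left _ _)),
      fun x hx => ⟨hfix x, h' x (ball_subset_ball (min_le_right _ _) hx)⟩⟩
  by_cases hc : 1 - 4 * c = 0
  · obtain ⟨s₀, hs₀⟩ := IsAlgClosed.exists_pow_nat_eq (-3 - 4 * c) two_pos
    obtain ⟨s, r, hr, hs, -, hsq⟩ := hsqrt (fun x => -3 - 4 * x) (by fun_prop)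
      (fun h => by
        have h' : (-4 : ℂ) = 0 := by linear_combination h - hc
        norm_num at h') s₀ hs₀
    refine hshrink (fun x => (-1 + s x) / 2) 2 r hr ((hs.const_add (-1)).div_const 2) ?_ ?_
    · intro x
      have h := hsq x
      simp only [Function.iterate_succ, Function.iterate_zero, Function.comp, id, f]
      linear_combination (s x ^ 2 / 16 - s x / 4 + 3 / 16 + x / 4) * h
    · have h := hsq c
      have : orbitDeriv c 2 ((-1 + s c) / 2) = 5 := by
        simp only [orbitDeriv, Finset.prod_range_succ, Finset.prod_range_zero,
          Function.iterate_succ, Function.iterate_zero, Function.comp, id, f]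
        linear_combination ((-1 + s c) / 2 - 1) * h - hc
      rw [this]
      norm_num
  · obtain ⟨s₀, hs₀, hre⟩ : ∃ s₀ : ℂ, s₀ ^ 2 = 1 - 4 * c ∧ 0 ≤ s₀.re := by
      obtain ⟨s₀, hs₀⟩ := IsAlgClosed.exists_pow_nat_eq (1 - 4 * c) two_pos
      rcases le_total 0 s₀.re with h | h
      · exact ⟨s₀, hs₀, h⟩
      · exact ⟨-s₀, by rw [neg_sq, hs₀], by simpa using h⟩
    obtain ⟨s, r, hr, hs, hsc, hsq⟩ := hsqrt (fun x => 1 - 4 * x) (by fun_prop) hc s₀ hs₀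
    refine hshrink (fun x => (1 + s x) / 2) 1 r hr ((hs.const_add 1).div_const 2) ?_ ?_
    · intro x
      have h := hsq x
      simp only [Function.iterate_one, f]
      linear_combination h / 4
    · have h1 : orbitDeriv c 1 ((1 + s c) / 2) = 1 + s₀ := by
        simp [orbitDeriv, hsc]; ring
      have hs0 : s₀ ≠ 0 := by
        rintro rfl
        exact hc (by rw [← hs₀]; ring)
      have h2 : 1 < Complex.normSq (1 + s₀) := by
        have := Complex.normSq_pos.2 hs0
        rw [Complex.normSq_apply] at this ⊢
        simp only [Complex.add_re, Complex.add_im, Complex.one_re, Complex.one_im]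
        nlinarith
      rw [h1]
      rw [Complex.normSq_eq_norm_sq] at h2
      nlinarith [norm_nonneg (1 + s₀)]

/-- Along an ultrafilter, a uniformly bounded family of holomorphic functions on a disc has a
holomorphic pointwise limit. -/
theorem exists_differentiableOn_limit {ι : Type*} (𝓤 : Ultrafilter ι) {F : ι → ℂ → ℂ} {c : ℂ}
    {r B : ℝ}
    (hF : ∀ᶠ n in 𝓤, DifferentiableOn ℂ (F n) (ball c r) ∧ ∀ x ∈ ball c r, ‖F n x‖ ≤ B) :
    ∃ G, DifferentiableOn ℂ G (ball c r) ∧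
      ∀ x ∈ ball c r, Tendsto (fun n => F n x) 𝓤 (𝓝 (G x)) := by
  have hex : ∀ x, ∃ w, x ∈ ball c r → Tendsto (fun n => F n x) 𝓤 (𝓝 w) := by
    intro x
    by_cases hx : x ∈ ball c r
    · have hmem : closedBall (0 : ℂ) B ∈ 𝓤.map fun n => F n x := by
        rw [Ultrafilter.mem_map]
        filter_upwards [hF] with n hn
        simpa using hn.2 x hx
      obtain ⟨w, -, hw⟩ := (isCompact_closedBall (0 : ℂ) B).ultrafilter_le_nhds' _ hmem
      exact ⟨w, fun _ => hw⟩
    · exact ⟨0, fun h => absurd h hx⟩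
  choose G hG using hex
  refine ⟨G, ?_, hG⟩
  have hloc : TendstoLocallyUniformlyOn F G 𝓤 (ball c r) := by
    rw [Metric.tendstoLocallyUniformlyOn_iff]
    intro ε hε x hx
    obtain ⟨ρ, hρ, hball⟩ := Metric.isOpen_iff.1 isOpen_ball x hx
    have hB0 : 0 ≤ B := by
      obtain ⟨n, hn⟩ := hF.exists
      exact (norm_nonneg _).trans (hn.2 x hx)
    have hlip : ∀ᶠ n in 𝓤, ∀ y ∈ ball x ρ, dist (F n y) (F n x) ≤ 2 * B / ρ * dist y x := by
      filter_upwards [hF] with n hn y hy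
      refine Complex.dist_le_div_mul_dist_of_mapsTo_ball (hn.1.mono hball) (fun w hw => ?_) hy
      rw [mem_closedBall, dist_eq_norm]
      calc _ ≤ ‖F n w‖ + ‖F n x‖ := norm_sub_le _ _
        _ ≤ 2 * B := by linarith [hn.2 w (hball hw), hn.2 x hx]
    have hlipG : ∀ y ∈ ball x ρ, dist (G y) (G x) ≤ 2 * B / ρ * dist y x := fun y hy =>
      le_of_tendsto ((hG y (hball hy)).dist (hG x hx)) (hlip.mono fun n hn => hn y hy)
    obtain ⟨η, hη, hηε⟩ : ∃ η > 0, 2 * B / ρ * η < ε / 3 := by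
      refine ⟨ε / 3 / (2 * B / ρ + 1), by positivity, ?_⟩
      rw [mul_div_assoc', div_lt_iff₀ (by positivity)]
      nlinarith
    refine ⟨ball x (min ρ η), mem_nhdsWithin_of_mem_nhds (ball_mem_nhds _ (lt_min hρ hη)), ?_⟩
    filter_upwards [hlip, (tendsto_iff_dist_tendsto_zero.1 (hG x hx)).eventually_lt_const
      (show 0 < ε / 3 by positivity)] with n hn hn' y hy
    have hy1 : y ∈ ball x ρ := ball_subset_ball (min_le_left _ _) hy
    have hy2 : 2 * B / ρ * dist y x ≤ 2 * B / ρ * η := by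
      have := (mem_ball.1 hy).le.trans (min_le_right ρ η)
      gcongr
    calc dist (G y) (F n y) ≤ dist (G y) (G x) + dist (G x) (F n x) + dist (F n x) (F n y) :=
          dist_triangle4 _ _ _ _
      _ < ε := by
        rw [dist_comm (G x) (F n x), dist_comm (F n x) (F n y)]
        linarith [hn y hy1, hlipG y hy1]
  exact hloc.differentiableOn (hF.mono fun n hn => hn.1) isOpen_ball

theorem exists_exp_eq_of_ne_zero {u : ℂ → ℂ} {c : ℂ} {r : ℝ} (hr : 0 < r)
    (hu : DifferentiableOn ℂ u (ball c r)) (h0 : ∀ x ∈ ball c r, u x ≠ 0) :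
    ∃ L, DifferentiableOn ℂ L (ball c r) ∧ L c = Complex.log (u c) ∧
      ∀ x ∈ ball c r, Complex.exp (L x) = u x := by
  have hd : DifferentiableOn ℂ (fun x => deriv u x / u x) (ball c r) :=
    (hu.deriv isOpen_ball).div hu h0
  obtain ⟨L, hLc, hL⟩ := hd.isExactOn_ball.with_val_at c (Complex.log (u c))
  have hLd : DifferentiableOn ℂ L (ball c r) :=
    fun x hx => (hL x hx).differentiableAt.differentiableWithinAt
  refine ⟨L, hLd, hLc, fun x hx => ?_⟩
  have hconst : Complex.exp (-L x) * u x = Complex.exp (-L c) * u c := by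
    refine isOpen_ball.is_const_of_deriv_eq_zero (s := ball c r)
      (f := fun x => Complex.exp (-L x) * u x)
      (convex_ball c r).isPreconnected (hLd.neg.cexp.mul hu) (fun y hy => ?_) hx
      (mem_ball_self hr)
    have h1 := ((hL y hy).neg.cexp).mul (hu.differentiableAt (isOpen_ball.mem_nhds hy)).hasDerivAt
    refine h1.deriv.trans ?_
    have := h0 y hy
    simp only [Pi.zero_apply]
    field_simp
    ring
  rw [hLc, Complex.exp_neg (Complex.log _), Complex.exp_log (h0 c (mem_ball_self hr)),
    inv_mul_cancel₀ (h0 c (mem_ball_self hr)), Complex.exp_neg, inv_mul_eq_one₀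
    (Complex.exp_ne_zero _)] at hconst
  exact hconst

/-- The normalised logarithms of zero-free holomorphic functions growing at most like
`exp (2 ^ n * M)` have a harmonic limit along any free ultrafilter. -/
theorem exists_log_norm_limit {𝓤 : Ultrafilter ℕ} (h𝓤 : ↑𝓤 ≤ (atTop : Filter ℕ))
    {u : ℕ → ℂ → ℂ} {c : ℂ} {r M η B : ℝ} (hr : 0 < r) (hη : 0 < η) (hM : 0 < M)
    (hu : ∀ n, DifferentiableOn ℂ (u n) (ball c r)) (h0 : ∀ n, ∀ x ∈ ball c r, u n x ≠ 0)
    (hle : ∀ n, ∀ x ∈ ball c r, ‖u n x‖ ≤ Real.exp (2 ^ n * M))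
    (hc : ∀ᶠ n in atTop, η ≤ ‖u n c‖ ∧ ‖u n c‖ ≤ B) :
    ∃ V : ℂ → ℂ, DifferentiableOn ℂ V (ball c (r / 2)) ∧ V c = 0 ∧
      ∀ x ∈ ball c (r / 2), Tendsto (fun n => Real.log ‖u n x‖ / 2 ^ n) 𝓤 (𝓝 (V x).re) := by
  choose L hLd hLc hL using fun n => exists_exp_eq_of_ne_zero hr (hu n) (h0 n)
  have hcr : c ∈ ball c r := mem_ball_self hr
  have hre : ∀ n, ∀ x ∈ ball c r, (L n x).re = Real.log ‖u n x‖ := by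
    intro n x hx
    rw [← hL n x hx, Complex.norm_exp, Real.log_exp]
  set C : ℝ := |Real.log η| + |Real.log B| + Real.pi with hC
  have hC0 : 0 ≤ C := by positivity
  have hlogc : ∀ᶠ n in atTop, ‖L n c‖ ≤ C := by
    filter_upwards [hc] with n hn
    refine (Complex.norm_le_abs_re_add_abs_im _).trans ?_
    rw [hLc]
    rw [Complex.log_im]
    refine add_le_add ?_ (Complex.abs_arg_le_pi _)
    have h1 : Real.log η ≤ Real.log ‖u n c‖ := Real.log_le_log hη hn.1
    have h2 : Real.log ‖u n c‖ ≤ Real.log B := Real.log_le_log (hη.trans_le hn.1) hn.2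
    rw [Complex.log_re, abs_le]
    constructor
    · linarith [neg_abs_le (Real.log η), abs_nonneg (Real.log B)]
    · linarith [le_abs_self (Real.log B), abs_nonneg (Real.log η)]
  have hnorm : ∀ n (w : ℂ), ‖w / 2 ^ n‖ = ‖w‖ / 2 ^ n := fun n w => by simp
  have hbound : ∀ᶠ n in atTop, ∀ x ∈ ball c (r / 2), ‖L n x / 2 ^ n‖ ≤ 2 * M + 3 * C := by
    filter_upwards [hlogc] with n hn x hx
    have hxr : ‖x - c‖ < r / 2 := by rwa [← dist_eq_norm]
    have hmap : Set.MapsTo (fun w => c + w) (ball 0 r) (ball c r) := fun w hw => by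
      simpa [dist_eq_norm] using hw
    have hd : DifferentiableOn ℂ (fun w => L n (c + w) / 2 ^ n) (ball 0 r) :=
      ((hLd n).comp (by fun_prop) hmap).div_const _
    have hmaps : Set.MapsTo (fun w => L n (c + w) / 2 ^ n) (ball 0 r) {z | z.re ≤ M} := by
      intro w hw
      have h1 := hre n _ (hmap hw)
      have h2 := Real.log_le_log (norm_pos_iff.2 (h0 n _ (hmap hw))) (hle n _ (hmap hw))
      rw [Real.log_exp] at h2
      have h3 : (L n (c + w) / 2 ^ n).re = (L n (c + w)).re / 2 ^ n := by
        rw [show (2 : ℂ) ^ n = ((2 ^ n : ℝ) : ℂ) by push_cast; rfl, Complex.div_ofReal_re]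
      simp only [Set.mem_ofPred_eq]
      rw [h3, h1, div_le_iff₀ (by positivity)]
      linarith
    have h := Complex.borelCaratheodory hM hd hmaps hr (z := x - c)
      (by rw [mem_ball_zero_iff]; linarith)
    simp only [add_sub_cancel, add_zero] at h
    refine h.trans ?_
    have hpos : 0 < r - ‖x - c‖ := by linarith
    have hcn : ‖L n c / 2 ^ n‖ ≤ C := by
      rw [hnorm]
      exact (div_le_self (norm_nonneg _) (one_le_pow₀ one_le_two)).trans hn
    refine add_le_add ?_ ?_
    · rw [div_le_iff₀ hpos]
      nlinarith
    · rw [div_le_iff₀ hpos]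
      nlinarith [norm_nonneg (L n c / 2 ^ n), norm_nonneg (x - c)]
  obtain ⟨V, hVd, hV⟩ := exists_differentiableOn_limit 𝓤 (F := fun n x => L n x / 2 ^ n)
    (c := c) (r := r / 2) (B := 2 * M + 3 * C) ((hbound.filter_mono h𝓤).mono fun n hn =>
      ⟨((hLd n).mono (ball_subset_ball (by linarith))).div_const _, hn⟩)
  have hc2 : c ∈ ball c (r / 2) := mem_ball_self (half_pos hr)
  refine ⟨V, hVd, ?_, fun x hx => ?_⟩
  · refine tendsto_nhds_unique (hV c hc2) (Tendsto.mono_left ?_ h𝓤)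
    refine squeeze_zero_norm' (a := fun n => C * (1 / 2) ^ n) ?_ ?_
    · filter_upwards [hlogc] with n hn
      rw [hnorm, one_div, inv_pow, ← div_eq_mul_inv]
      gcongr
    · simpa using (tendsto_pow_atTop_nhds_zero_of_lt_one (r := (1 / 2 : ℝ)) (by norm_num)
        (by norm_num)).const_mul C
  · refine ((Complex.continuous_re.tendsto _).comp (hV x hx)).congr fun n => ?_
    rw [← hre n x (ball_subset_ball (by linarith) hx), Function.comp,
      show (2 : ℂ) ^ n = ((2 ^ n : ℝ) : ℂ) by push_cast; rfl, Complex.div_ofReal_re]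

theorem eqOn_const_of_re_le {g : ℂ → ℂ} {c x : ℂ} {r : ℝ} {t : Set ℂ}
    (hg : DifferentiableOn ℂ g (ball c r)) (ht : IsOpen t) (hsub : t ⊆ ball c r) (hx : x ∈ t)
    (hre : ∀ y ∈ t, (g x).re ≤ (g y).re) : ∀ y ∈ ball c r, g y = g x := by
  rcases (hg.analyticOnNhd isOpen_ball).is_constant_or_isOpen
    (convex_ball c r).isPreconnected with ⟨w, hw⟩ | h
  · exact fun y hy => (hw y hy).trans (hw x (hsub hx)).symm
  · obtain ⟨ε, hε, hball⟩ := Metric.isOpen_iff.1 (h t hsub ht) (g x) ⟨x, hx, rfl⟩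
    obtain ⟨y, hy, hyx⟩ := hball (show g x - ((ε / 2 : ℝ) : ℂ) ∈ ball (g x) ε by
      rw [mem_ball, dist_eq_norm, sub_sub_cancel_left, norm_neg, Complex.norm_real,
        Real.norm_of_nonneg (by positivity)]
      exact half_lt_self hε)
    have h1 := hre y hy
    rw [hyx, Complex.sub_re, Complex.ofReal_re] at h1
    linarith

theorem isClosed_setOf_mem_K (z : ℂ) : IsClosed {x | z ∈ K x} := by
  have h : {x | z ∈ K x} = ⋂ n : ℕ, {x | ‖(f x)^[n] z‖ ≤ ‖x‖ + 2} := by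
    ext x; simp [mem_K_iff]
  rw [h]
  refine isClosed_iInter fun n => isClosed_le ?_ (by fun_prop)
  have hd := differentiableOn_iterate_f (s := Set.univ) (differentiableOn_const z) n
  exact (differentiableOn_univ.1 hd).continuous.norm

theorem exp_two_pow_mul_log {x : ℝ} (hx : 0 < x) (n : ℕ) :
    Real.exp (2 ^ n * Real.log x) = x ^ 2 ^ n := by
  rw [show (2 : ℝ) ^ n = ((2 ^ n : ℕ) : ℝ) by push_cast; rfl, Real.exp_nat_mul, Real.exp_log hx]

theorem exists_exp_le_norm_iterate {c w : ℂ} (hw : w ∉ K c) :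
    ∃ κ > 0, ∀ᶠ n in atTop, 2 * Real.exp (2 ^ n * κ) ≤ ‖(f c)^[n] w‖ := by
  rw [mem_K_iff] at hw
  push Not at hw
  obtain ⟨N, hN⟩ := hw
  have hρ : 1 < ‖(f c)^[N] w‖ / 2 := by linarith [norm_nonneg c]
  refine ⟨Real.log (‖(f c)^[N] w‖ / 2) / 2 ^ N, div_pos (Real.log_pos hρ) (by positivity), ?_⟩
  filter_upwards [eventually_ge_atTop N] with n hn
  obtain ⟨j, rfl⟩ := Nat.exists_eq_add_of_le' hn
  have h := (iterate_f_growth hN j).2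
  rw [← Function.iterate_add_apply] at h
  convert h using 2
  rw [pow_add, mul_assoc, mul_div_cancel₀ _ (by positivity),
    exp_two_pow_mul_log (by linarith)]

theorem norm_iterate_add_le {x z : ℂ} {A : ℝ} (hA : ‖x‖ ≤ A) (n : ℕ) :
    ‖(f x)^[n] z‖ + A + 1 ≤ (‖z‖ + A + 1) ^ 2 ^ n := by
  have hA0 : 0 ≤ A := (norm_nonneg x).trans hA
  induction n with
  | zero => simp
  | succ n ih =>
    have h1 : ‖(f x)^[n + 1] z‖ ≤ ‖(f x)^[n] z‖ ^ 2 + A := by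
      rw [iterate_f_succ]
      refine (norm_add_le _ _).trans ?_
      rw [norm_pow]
      gcongr
    have h2 : (‖(f x)^[n] z‖ + A + 1) ^ 2 ≤ ((‖z‖ + A + 1) ^ 2 ^ n) ^ 2 := by gcongr
    rw [pow_succ 2 n, pow_mul]
    nlinarith [norm_nonneg ((f x)^[n] z)]

theorem tendsto_le_of_log_le {𝓤 : Ultrafilter ℕ} (h𝓤 : ↑𝓤 ≤ (atTop : Filter ℕ)) {a b : ℕ → ℂ}
    {v w : ℝ} (hb : ∀ n, a n ≠ 0) (ha : Tendsto (fun n => Real.log ‖a n‖ / 2 ^ n) 𝓤 (𝓝 v))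
    (hw : Tendsto (fun n => Real.log ‖b n‖ / 2 ^ n) 𝓤 (𝓝 w))
    (hab : ∀ᶠ n in atTop, ‖a n‖ ≤ 2 * ‖b n‖) : v ≤ w := by
  have h0 : Tendsto (fun n : ℕ => Real.log 2 * (1 / 2) ^ n + Real.log ‖b n‖ / 2 ^ n) 𝓤 (𝓝 w) := by
    have := (tendsto_pow_atTop_nhds_zero_of_lt_one (r := (1 / 2 : ℝ)) (by norm_num)
        (by norm_num)).const_mul (Real.log 2)
    simpa using (this.mono_left h𝓤).add hw
  refine le_of_tendsto_of_tendsto ha h0 ?_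
  filter_upwards [hab.filter_mono h𝓤] with n hn
  have ha0 : 0 < ‖a n‖ := norm_pos_iff.2 (hb n)
  have hb0 : ‖b n‖ ≠ 0 := fun h => by rw [h] at hn; linarith
  have h1 := Real.log_le_log ha0 hn
  rw [Real.log_mul two_ne_zero hb0] at h1
  rw [one_div, inv_pow, ← div_eq_mul_inv, ← add_div]
  gcongr

/-- If the orbit of `z` avoids `α` and `-α` for all parameters in a disc, and stays away from both
at the centre, then `z` has bounded orbit for all parameters in the concentric half disc. -/
theorem mem_K_of_forall_iterate_ne {c z : ℂ} {r η B : ℝ} {α : ℂ → ℂ} (hr : 0 < r) (hη : 0 < η)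
    (hα : DifferentiableOn ℂ α (ball c r)) (hα0 : ∀ x ∈ ball c r, α x ≠ 0)
    (hαK : ∀ x ∈ ball c r, ‖α x‖ ≤ ‖x‖ + 2)
    (hne : ∀ x ∈ ball c r, ∀ n, (f x)^[n] z ≠ α x ∧ (f x)^[n] z ≠ -α x)
    (hsub : ∀ᶠ n in atTop, η ≤ ‖(f c)^[n] z - α c‖ ∧ ‖(f c)^[n] z - α c‖ ≤ B)
    (hadd : ∀ᶠ n in atTop, η ≤ ‖(f c)^[n] z + α c‖ ∧ ‖(f c)^[n] z + α c‖ ≤ B) :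
    ∀ x ∈ ball c (r / 2), z ∈ K x := by
  by_contra! hcon
  obtain ⟨x₁, hx₁, hz⟩ := hcon
  set A : ℝ := ‖c‖ + r + 2 with hAdef
  have hxA : ∀ x ∈ ball c r, ‖x‖ + 2 ≤ A := by
    intro x hx
    have h1 := norm_le_norm_add_norm_sub' x c
    have h2 : ‖x - c‖ < r := by rwa [← dist_eq_norm]
    linarith
  have hαA : ∀ x ∈ ball c r, ‖α x‖ ≤ A := fun x hx => (hαK x hx).trans (hxA x hx)
  have hA2 : 2 ≤ A := by linarith [norm_nonneg c]
  have hM : 0 < Real.log (‖z‖ + A + 1) := Real.log_pos (by linarith [norm_nonneg z])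
  have hexp : ∀ n, ∀ x ∈ ball c r,
      ‖(f x)^[n] z‖ + ‖α x‖ ≤ Real.exp (2 ^ n * Real.log (‖z‖ + A + 1)) := by
    intro n x hx
    have h1 := norm_iterate_add_le (z := z) (show ‖x‖ ≤ A by linarith [hxA x hx]) n
    rw [exp_two_pow_mul_log (by linarith [norm_nonneg z])]
    linarith [hαA x hx]
  have hd : ∀ n, DifferentiableOn ℂ (fun x => (f x)^[n] z) (ball c r) := fun n =>
    differentiableOn_iterate_f (differentiableOn_const z) n
  have h𝓤 : ↑(hyperfilter ℕ) ≤ (atTop : Filter ℕ) := Nat.hyperfilter_le_atTop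
  have hu0 : ∀ n, ∀ x ∈ ball c r, (f x)^[n] z - α x ≠ 0 := fun n x hx =>
    sub_ne_zero.2 (hne x hx n).1
  have hw0 : ∀ n, ∀ x ∈ ball c r, (f x)^[n] z + α x ≠ 0 := fun n x hx h =>
    (hne x hx n).2 (eq_neg_of_add_eq_zero_left h)
  obtain ⟨V, hVd, hVc, hV⟩ := exists_log_norm_limit h𝓤 (u := fun n x => (f x)^[n] z - α x) hr hη hM
    (fun n => (hd n).sub hα) hu0 (fun n x hx => (norm_sub_le _ _).trans (hexp n x hx)) hsub
  obtain ⟨W, hWd, hWc, hW⟩ := exists_log_norm_limit h𝓤 (u := fun n x => (f x)^[n] z + α x) hr hη hM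
    (fun n => (hd n).add hα) hw0 (fun n x hx => (norm_add_le _ _).trans (hexp n x hx)) hadd
  have hsubset : ball c (r / 2) ⊆ ball c r := ball_subset_ball (by linarith)
  have hlarge : ∀ x, z ∉ K x → ∀ᶠ n in atTop, 3 * A ≤ ‖(f x)^[n] z‖ := by
    intro x hx
    obtain ⟨κ, hκ, h⟩ := exists_exp_le_norm_iterate hx
    have ht : Tendsto (fun n : ℕ => (2 : ℝ) ^ n * κ) atTop atTop :=
      (tendsto_pow_atTop_atTop_of_one_lt one_lt_two).atTop_mul_const hκ
    filter_upwards [h, ht.eventually_ge_atTop (3 * A)] with n h1 h2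
    linarith [Real.add_one_le_exp ((2 : ℝ) ^ n * κ)]
  have hVW : ∀ x ∈ ball c (r / 2), z ∉ K x → (V x).re = (W x).re := by
    intro x hx hxK
    have hxr := hsubset hx
    refine le_antisymm ?_ ?_
    · refine tendsto_le_of_log_le h𝓤 (fun n => hu0 n x hxr) (hV x hx) (hW x hx) ?_
      filter_upwards [hlarge x hxK] with n hn
      have h1 := norm_sub_le ((f x)^[n] z) (α x)
      have h2 := norm_sub_le_norm_add ((f x)^[n] z) (α x)
      linarith [hαA x hxr]
    · refine tendsto_le_of_log_le h𝓤 (fun n => hw0 n x hxr) (hW x hx) (hV x hx) ?_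
      filter_upwards [hlarge x hxK] with n hn
      have h1 := norm_add_le ((f x)^[n] z) (α x)
      have h2 := norm_sub_norm_le ((f x)^[n] z) (α x)
      linarith [hαA x hxr]
  have hc2 : c ∈ ball c (r / 2) := mem_ball_self (half_pos hr)
  have hEq : ∀ x ∈ ball c (r / 2), W x = V x := by
    have hopen : IsOpen (ball c (r / 2) ∩ {x | z ∈ K x}ᶜ) :=
      isOpen_ball.inter (isClosed_setOf_mem_K z).isOpen_compl
    have h := eqOn_const_of_re_le (hVd.sub hWd) hopen Set.inter_subset_left ⟨hx₁, by simpa using hz⟩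
      (fun y hy => by
        have hyK : z ∉ K y := by simpa using hy.2
        simp [hVW y hy.1 hyK, hVW x₁ hx₁ hz])
    intro x hx
    have h1 := (h x hx).trans (h c hc2).symm
    simp only [Pi.sub_apply, hVc, hWc, sub_self] at h1
    exact (sub_eq_zero.1 h1).symm
  have hnonneg : ∀ x ∈ ball c (r / 2), 0 ≤ (V x).re := by
    intro x hx
    by_contra! hneg
    have hsmall : ∀ u : ℕ → ℂ, (∀ n, u n ≠ 0) →
        Tendsto (fun n => Real.log ‖u n‖ / 2 ^ n) (hyperfilter ℕ) (𝓝 (V x).re) →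
        ∀ᶠ n in (hyperfilter ℕ : Filter ℕ), ‖u n‖ < ‖α x‖ := by
      intro u hu0 hu
      have ht := ((tendsto_pow_atTop_atTop_of_one_lt (one_lt_two (α := ℝ))).mono_left
        h𝓤).atTop_mul_neg hneg hu
      filter_upwards [ht.eventually_lt_atBot (Real.log ‖α x‖)] with n hn
      rw [mul_div_cancel₀ _ (by positivity)] at hn
      exact (Real.log_lt_log_iff (norm_pos_iff.2 (hu0 n))
        (norm_pos_iff.2 (hα0 x (hsubset hx)))).1 hn
    have hW' := hW x hx
    rw [hEq x hx] at hW'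
    obtain ⟨n, h1, h2⟩ := ((hsmall _ (fun n => hu0 n x (hsubset hx)) (hV x hx)).and
      (hsmall _ (fun n => hw0 n x (hsubset hx)) hW')).exists
    have h3 := norm_sub_le ((f x)^[n] z + α x) ((f x)^[n] z - α x)
    rw [show (f x)^[n] z + α x - ((f x)^[n] z - α x) = 2 * α x by ring, norm_mul,
      Complex.norm_ofNat] at h3
    linarith
  have hconst := eqOn_const_of_re_le hVd isOpen_ball subset_rfl hc2
    (fun y hy => by simpa [hVc] using hnonneg y hy) x₁ hx₁
  obtain ⟨κ, hκ, h⟩ := exists_exp_le_norm_iterate hz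
  have hle : κ ≤ (V x₁).re := by
    refine ge_of_tendsto (hV x₁ hx₁) ?_
    filter_upwards [h.filter_mono h𝓤, (hlarge x₁ hz).filter_mono h𝓤] with n h1 h2
    have h3 := norm_sub_norm_le ((f x₁)^[n] z) (α x₁)
    have h4 := hαA x₁ (hsubset hx₁)
    rw [le_div_iff₀ (by positivity), mul_comm,
      Real.le_log_iff_exp_le (norm_pos_iff.2 (hu0 n x₁ (hsubset hx₁)))]
    linarith
  rw [hconst, hVc, Complex.zero_re] at hle
  linarith

theorem iterate_eq_of_orbit_bounded {c : ℂ} {r R : ℝ} {g : ℂ → ℂ} {M : ℕ} (hr : 0 < r)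
    (hg : DifferentiableOn ℂ g (ball c r)) (hfix : (f c)^[M] (g c) = g c)
    (hpar : orbitDeriv c M (g c) = 1)
    (hR : ∀ x ∈ ball c r, ∀ j, ‖(f x)^[M * j] (g x)‖ ≤ R) :
    ∀ x ∈ ball c r, (f x)^[M] (g x) = g x := by
  have hcr : c ∈ ball c r := mem_ball_self hr
  have hit := differentiableOn_iterate_f hg
  have hD : AnalyticOnNhd ℂ (fun x => (f x)^[M] (g x) - g x) (ball c r) :=
    ((hit M).sub hg).analyticOnNhd isOpen_ball
  by_cases hzero : ∀ᶠ x in 𝓝 c, (f x)^[M] (g x) - g x = 0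
  · intro x hx
    exact sub_eq_zero.1 (hD.eqOn_zero_of_preconnected_of_eventuallyEq_zero
      (convex_ball c r).isPreconnected hcr hzero hx)
  exfalso
  obtain ⟨s, E, hE, hEc, hDE⟩ := (hD c hcr).exists_eventuallyEq_pow_smul_nonzero_iff.2 hzero
  obtain ⟨ρ, hρ, hball⟩ := Metric.nhds_basis_closedBall.eventually_iff.1
    ((hE.eventually_analyticAt.and hDE).and (isOpen_ball.eventually_mem hcr))
  set P : ℕ → ℂ → ℂ := fun j x => ∑ i ∈ Finset.range j, ∏ l ∈ Finset.range (M * i),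
    ((f x)^[l] ((f x)^[M] (g x)) + (f x)^[l] (g x)) with hP
  have hPd : ∀ j, DifferentiableOn ℂ (P j) (ball c r) := fun j =>
    DifferentiableOn.fun_sum fun i _ => DifferentiableOn.fun_finsetProd fun l _ =>
      (differentiableOn_iterate_f (hit M) l).add (hit l)
  have hPc : ∀ j, P j c = j := by
    intro j
    have h : ∀ i, ∏ l ∈ Finset.range (M * i),
        ((f c)^[l] ((f c)^[M] (g c)) + (f c)^[l] (g c)) = 1 := by
      intro i
      rw [hfix]
      have h1 := orbitDeriv_mul hfix i
      rw [hpar, one_pow] at h1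
      rw [← h1]
      exact Finset.prod_congr rfl fun l _ => by ring
    simp [hP, h]
  have hPG : ∀ j x, (f x)^[M * j] (g x) - g x = ((f x)^[M] (g x) - g x) * P j x := by
    intro j x
    have h := Finset.sum_range_sub (fun j => (f x)^[M * j] (g x)) j
    simp only [mul_zero, Function.iterate_zero, id] at h
    rw [← h, hP, Finset.mul_sum]
    refine Finset.sum_congr rfl fun i _ => ?_
    rw [mul_add, mul_one, Function.iterate_add_apply, iterate_f_sub_iterate_f]
  have hsub : closedBall c ρ ⊆ ball c r := fun x hx => (hball hx).2
  have hle : ∀ j : ℕ, j * ‖E c‖ ≤ 2 * R / ρ ^ s := by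
    intro j
    have hdiff : DifferentiableOn ℂ (fun x => E x * P j x) (closedBall c ρ) :=
      DifferentiableOn.mul (fun x hx => (hball hx).1.1.differentiableAt.differentiableWithinAt)
        ((hPd j).mono hsub)
    have h := Complex.norm_le_of_forall_mem_frontier_norm_le (U := ball c ρ) (C := 2 * R / ρ ^ s)
      isBounded_ball (DifferentiableOn.diffContOnCl (by rwa [closure_ball c hρ.ne'])) (fun x hx => ?_)
      (subset_closure (mem_ball_self hρ))
    · rwa [hPc, norm_mul, Complex.norm_natCast, mul_comm] at h
    · rw [frontier_ball c hρ.ne'] at hx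
      have hxc := sphere_subset_closedBall hx
      rw [mem_sphere, dist_eq_norm] at hx
      rw [le_div_iff₀ (by positivity), ← hx, ← norm_pow, ← norm_mul]
      have h1 := hPG j x
      rw [(hball hxc).1.2, smul_eq_mul] at h1
      rw [show E x * P j x * (x - c) ^ s = (x - c) ^ s * E x * P j x by ring, ← h1]
      have h2 := hR x (hsub hxc) j
      have h3 := hR x (hsub hxc) 0
      rw [mul_zero, Function.iterate_zero, id] at h3
      linarith [norm_sub_le ((f x)^[M * j] (g x)) (g x)]
  obtain ⟨j, hj⟩ := exists_nat_gt (2 * R / ρ ^ s / ‖E c‖)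
  rw [div_lt_iff₀ (norm_pos_iff.2 hEc)] at hj
  exact absurd (hle j) (not_le.2 hj)

theorem eq_of_tendsto_of_repelling {F : ℂ → ℂ} {p μ : ℂ} {v : ℕ → ℂ} {M : ℕ} {l : Filter ℕ}
    [l.NeBot] (hl : l ≤ atTop) (hF : HasDerivAt F μ p) (hp : F p = p) (hμ : 1 < ‖μ‖)
    (hv : ∀ n, v (n + M) = F (v n)) (hlim : Tendsto v l (𝓝 p))
    (hdiff : Tendsto (fun n => v (n + M) - v n) atTop (𝓝 0)) : ∃ n, v n = p := by
  obtain ⟨κ, hκ1, hκ⟩ := exists_between hμ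
  have hexp : ∀ᶠ y in 𝓝 p, κ * ‖y - p‖ ≤ ‖F y - p‖ := by
    filter_upwards [(hasDerivAt_iff_isLittleO.1 hF).def (sub_pos.2 hκ)] with y hy
    rw [hp] at hy
    have h1 := norm_sub_norm_le ((y - p) • μ) ((y - p) • μ - (F y - p))
    rw [sub_sub_cancel, norm_sub_rev, norm_smul] at h1
    linarith
  obtain ⟨ε, hε, hball⟩ := Metric.nhds_basis_closedBall.eventually_iff.1 hexp
  set δ := min ((κ - 1) * (ε / 2)) (ε / 2)
  have hδ : 0 < δ := lt_min (mul_pos (sub_pos.2 hκ1) (half_pos hε)) (half_pos hε)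
  obtain ⟨N, hN⟩ := eventually_atTop.1
    ((tendsto_zero_iff_norm_tendsto_zero.1 hdiff).eventually_le_const hδ)
  obtain ⟨n, hnp, hnN⟩ := ((hlim.eventually_mem (closedBall_mem_nhds p hε)).and
    (hl (eventually_ge_atTop N))).exists
  have hstep : ∀ k, N ≤ k → v k ∈ closedBall p ε →
      κ * ‖v k - p‖ ≤ ‖v (k + M) - p‖ ∧ v (k + M) ∈ closedBall p ε := by
    intro k hk hkp
    have h1 := hball hkp
    rw [← hv] at h1
    have h2 := hN k hk
    have h3 : ‖v (k + M) - p‖ ≤ ‖v (k + M) - v k‖ + ‖v k - p‖ :=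
      norm_sub_le_norm_sub_add_norm_sub _ _ _
    have h4 : δ ≤ (κ - 1) * (ε / 2) := min_le_left _ _
    have h5 : δ ≤ ε / 2 := min_le_right _ _
    have h6 : ‖v k - p‖ ≤ ε / 2 := by
      refine le_of_mul_le_mul_left ?_ (sub_pos.2 hκ1)
      linarith
    refine ⟨h1, ?_⟩
    rw [mem_closedBall, dist_eq_norm]
    linarith
  have hall : ∀ j, κ ^ j * ‖v n - p‖ ≤ ‖v (n + M * j) - p‖ ∧ v (n + M * j) ∈ closedBall p ε := by
    intro j
    induction j with
    | zero => simpa using hnp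
    | succ j ih =>
      obtain ⟨h1, h2⟩ := hstep (n + M * j) (by omega) ih.2
      rw [mul_add, mul_one, ← add_assoc]
      refine ⟨le_trans ?_ h1, h2⟩
      rw [pow_succ', mul_assoc]
      exact mul_le_mul_of_nonneg_left ih.1 (by linarith)
  refine ⟨n, ?_⟩
  by_contra hne
  have hpos : 0 < ‖v n - p‖ := norm_pos_iff.2 (sub_ne_zero.2 hne)
  obtain ⟨j, hj⟩ := pow_unbounded_of_one_lt (ε / ‖v n - p‖) hκ1
  rw [div_lt_iff₀ hpos] at hj
  have h := (hall j).2
  rw [mem_closedBall, dist_eq_norm] at h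
  linarith [(hall j).1]

/-- If every limit point of the orbit of `z` under `f c` is periodic with multiplier one, then the
orbits of `z` cannot be bounded near `c` without `z` lying in a nearby Julia set. -/
theorem exists_mem_J_of_forall_mem_K {c z : ℂ} {r : ℝ} {M : ℕ} (hr : 0 < r) (hM : 1 ≤ M)
    (hK : ∀ x ∈ ball c r, z ∈ K x)
    (hlim : ∀ 𝓤 : Ultrafilter ℕ, ↑𝓤 ≤ (atTop : Filter ℕ) → ∀ p,
      Tendsto (fun n => (f c)^[n] z) 𝓤 (𝓝 p) → (f c)^[M] p = p ∧ orbitDeriv c M p = 1) :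
    ∃ x ∈ ball c r, z ∈ J x := by
  have hcr : c ∈ ball c r := mem_ball_self hr
  have hbound : ∀ x ∈ ball c r, ∀ n, ‖(f x)^[n] z‖ ≤ ‖c‖ + r + 2 := by
    intro x hx n
    have h1 := norm_le_norm_add_norm_sub' x c
    have h2 : ‖x - c‖ < r := by rwa [← dist_eq_norm]
    linarith [mem_K_iff.1 (hK x hx) n]
  have hG : ∀ 𝓤 : Ultrafilter ℕ, ↑𝓤 ≤ (atTop : Filter ℕ) →
      ∃ G : ℂ → ℂ, DifferentiableOn ℂ G (ball c r) ∧ orbitDeriv c M (G c) = 1 ∧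
        (∀ x ∈ ball c r, (f x)^[M] (G x) = G x) ∧
        ∀ x ∈ ball c r, Tendsto (fun n => (f x)^[n] z) 𝓤 (𝓝 (G x)) := by
    intro 𝓤 h𝓤
    obtain ⟨G, hGd, hGt⟩ := exists_differentiableOn_limit 𝓤 (F := fun n x => (f x)^[n] z)
      (c := c) (r := r) (B := ‖c‖ + r + 2) (Eventually.of_forall fun n =>
        ⟨differentiableOn_iterate_f (differentiableOn_const z) n, fun x hx => hbound x hx n⟩)
    obtain ⟨h1, h2⟩ := hlim 𝓤 h𝓤 _ (hGt c hcr)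
    refine ⟨G, hGd, h2, iterate_eq_of_orbit_bounded (R := ‖c‖ + r + 2) hr hGd h1 h2
      fun x hx j => ?_, hGt⟩
    have ht := (((continuous_iterate_f x (M * j)).tendsto _).comp (hGt x hx)).norm
    refine le_of_tendsto ht (Eventually.of_forall fun n => ?_)
    simp only [Function.comp, ← Function.iterate_add_apply]
    exact hbound x hx _
  have hdiff : ∀ x ∈ ball c r,
      Tendsto (fun n => (f x)^[n + M] z - (f x)^[n] z) atTop (𝓝 0) := by
    intro x hx
    rw [tendsto_iff_ultrafilter]
    intro 𝓤 h𝓤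
    obtain ⟨G, -, -, hfix, hGt⟩ := hG 𝓤 h𝓤
    have h1 := (((continuous_iterate_f x M).tendsto _).comp (hGt x hx)).sub (hGt x hx)
    rw [hfix x hx, sub_self] at h1
    refine h1.congr fun n => ?_
    simp only [Function.comp, ← Function.iterate_add_apply, add_comm]
  obtain ⟨G, hGd, hGc, hfix, hGt⟩ := hG (hyperfilter ℕ) Nat.hyperfilter_le_atTop
  obtain ⟨x, hx, hrep⟩ : ∃ x ∈ ball c r, 1 < ‖orbitDeriv x M (G x)‖ := by
    by_contra! hcon
    have hd : DifferentiableOn ℂ (fun x => -orbitDeriv x M (G x)) (ball c r) :=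
      (DifferentiableOn.fun_finsetProd fun i _ =>
        (differentiableOn_iterate_f hGd i).const_mul 2).neg
    have hconst := eqOn_const_of_re_le hd isOpen_ball subset_rfl hcr (fun y hy => by
      rw [hGc, Complex.neg_re, Complex.neg_re, Complex.one_re, neg_le_neg_iff]
      exact (Complex.re_le_norm _).trans (hcon y hy))
    obtain ⟨x, hx, hint⟩ := exists_isIntegral_mem_ball c hr
    have h := hconst x hx
    rw [hGc, neg_inj] at h
    exact orbitDeriv_ne_one_of_isIntegral hint hM (hfix x hx) h
  refine ⟨x, hx, ?_⟩
  obtain ⟨n, hn⟩ := eq_of_tendsto_of_repelling (v := fun n => (f x)^[n] z)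
    Nat.hyperfilter_le_atTop (hasDerivAt_iterate_f x M (G x)) (hfix x hx) hrep
    (fun n => by rw [add_comm, Function.iterate_add_apply]) (hGt x hx) (hdiff x hx)
  exact mem_J_of_iterate_mem_J n (hn ▸ mem_J_of_repelling (hfix x hx) hrep)

theorem iterate_f_neg (c w : ℂ) {k : ℕ} (hk : 1 ≤ k) : (f c)^[k] (-w) = (f c)^[k] w := by
  obtain ⟨j, rfl⟩ := Nat.exists_eq_add_of_le' hk
  rw [Function.iterate_succ_apply, Function.iterate_succ_apply]
  simp [f]

theorem eventually_norm_sub_mem_of_notMem {S : Set ℂ} {v : ℕ → ℂ} {a : ℂ} (hS : IsCompact S)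
    (hne : S.Nonempty) (hv : Tendsto (fun n => infDist (v n) S) atTop (𝓝 0)) (ha : a ∉ S) :
    ∃ η > 0, ∃ B, ∀ᶠ n in atTop, η ≤ ‖v n - a‖ ∧ ‖v n - a‖ ≤ B := by
  have hpos : 0 < infDist a S := (hS.isClosed.notMem_iff_infDist_pos hne).1 ha
  obtain ⟨C, hC⟩ := hS.isBounded.exists_norm_le
  refine ⟨infDist a S / 2, half_pos hpos, 1 + C + ‖a‖, ?_⟩
  filter_upwards [hv.eventually_lt_const (half_pos hpos), hv.eventually_lt_const one_pos]
    with n h1 h2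
  constructor
  · have h3 : infDist a S ≤ infDist (v n) S + dist a (v n) := infDist_le_infDist_add_dist
    rw [dist_comm, dist_eq_norm] at h3
    linarith
  · obtain ⟨y, hy, hvy⟩ := (infDist_lt_iff hne).1 h2
    rw [dist_eq_norm] at hvy
    have h3 := norm_sub_le (v n) a
    have h4 := norm_le_norm_add_norm_sub' (v n) y
    linarith [hC y hy]

/-- If the orbit of `z` under `f_c` converges to a parabolic periodic orbit
`{ζ, f_c(ζ), …, f_c^[m-1](ζ)}` of `f_c`, then `(z,c) ∈ 𝕁`. -/
theorem mem_bbJ_of_orbit_tendsto_parabolic (c : ℂ) (m : ℕ) (hm : 1 ≤ m) (ζ : ℂ)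
    (hζ : (f c)^[m] ζ = ζ) (hpar : IsRootOfUnity (deriv ((f c)^[m]) ζ)) (z : ℂ)
    (hconv : Tendsto (fun n : ℕ =>
        Metric.infDist ((f c)^[n] z) ((fun i : ℕ => (f c)^[i] ζ) '' Set.Iio m))
      atTop (nhds 0)) :
    (z, c) ∈ bbJ := by
  obtain ⟨q, hq, hpar⟩ := hpar
  rw [(hasDerivAt_iterate_f c m ζ).deriv] at hpar
  set S : Set ℂ := (fun i : ℕ => (f c)^[i] ζ) '' Set.Iio m with hS
  have hSc : IsCompact S := ((Set.finite_Iio m).image _).isCompact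
  have hSne : S.Nonempty := ⟨ζ, 0, Set.mem_Iio.2 hm, rfl⟩
  have hSit : ∀ n, ∀ p ∈ S, (f c)^[n] p ∈ S := by
    rintro n _ ⟨i, -, rfl⟩
    refine ⟨(n + i) % m, by simpa using Nat.mod_lt _ hm, ?_⟩
    simp only [← Function.iterate_add_apply]
    conv_rhs => rw [← Nat.mod_add_div (n + i) m]
    rw [Function.iterate_add_apply, iterate_mul_fixed hζ]
  have hSpar : ∀ p ∈ S, (f c)^[m * q] p = p ∧ orbitDeriv c (m * q) p = 1 := by
    rintro _ ⟨i, hi, rfl⟩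
    have hne : orbitDeriv c m ζ ≠ 0 := by
      intro h
      rw [h, zero_pow (by omega)] at hpar
      exact zero_ne_one hpar
    have hfix : (f c)^[m] ((f c)^[i] ζ) = (f c)^[i] ζ := by
      rw [← Function.iterate_add_apply, add_comm, Function.iterate_add_apply, hζ]
    have hi' : i ≤ m := (Set.mem_Iio.1 hi).le
    refine ⟨iterate_mul_fixed hfix q, ?_⟩
    rw [orbitDeriv_mul hfix, orbitDeriv_cycle hζ (orbitDeriv_ne_zero_of_le hi' hne), hpar]
  by_contra hcon
  obtain ⟨δ, hδ, hJ⟩ : ∃ δ > 0, ∀ x ∈ ball c δ, z ∉ J x := by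
    rw [bbJ, Metric.mem_closure_iff] at hcon
    push Not at hcon
    obtain ⟨δ, hδ, h⟩ := hcon
    refine ⟨δ, hδ, fun x hx hzx => absurd (h (z, x) hzx) (not_le.2 ?_)⟩
    rw [Prod.dist_eq, dist_self, dist_comm c x]
    exact max_lt hδ hx
  obtain ⟨α, k, r, hr, hαd, hα⟩ := exists_repelling_continuation c
  set r' := min r δ
  have hr' : 0 < r' := lt_min hr hδ
  have hsub : ball c r' ⊆ ball c r := ball_subset_ball (min_le_left _ _)
  have hJ' : ∀ x ∈ ball c r', z ∉ J x := fun x hx => hJ x (ball_subset_ball (min_le_right _ _) hx)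
  have hαJ : ∀ x ∈ ball c r', α x ∈ J x := fun x hx =>
    mem_J_of_repelling (hα x (hsub hx)).1 (hα x (hsub hx)).2
  have hαk : ∀ x ∈ ball c r', 1 ≤ k ∧ α x ≠ 0 := fun x hx =>
    ne_zero_of_one_lt_norm_orbitDeriv (hα x (hsub hx)).2
  have hneg : ∀ x ∈ ball c r', (f x)^[k] (-α x) = α x := fun x hx => by
    rw [iterate_f_neg x _ (hαk x hx).1, (hα x (hsub hx)).1]
  have hcr : c ∈ ball c r' := mem_ball_self hr'
  have hαS : α c ∉ S := by
    intro h
    obtain ⟨hfix, hone⟩ := hSpar _ h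
    obtain ⟨hk, hrep⟩ := hα c (hsub hcr)
    have h1 := orbitDeriv_mul hfix k
    rw [hone, one_pow, mul_comm, orbitDeriv_mul hk] at h1
    have h2 := one_lt_pow₀ hrep (n := m * q) (Nat.mul_pos hm hq).ne'
    rw [← norm_pow, h1, norm_one] at h2
    exact lt_irrefl _ h2
  have hαS' : -α c ∉ S := fun h => hαS (hneg c hcr ▸ hSit k _ h)
  obtain ⟨η₁, hη₁, B₁, h₁⟩ := eventually_norm_sub_mem_of_notMem hSc hSne hconv hαS
  obtain ⟨η₂, hη₂, B₂, h₂⟩ := eventually_norm_sub_mem_of_notMem hSc hSne hconv hαS'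
  have hK := mem_K_of_forall_iterate_ne (z := z) (B := max B₁ B₂) hr' (lt_min hη₁ hη₂)
    (hαd.mono hsub) (fun x hx => (hαk x hx).2)
    (fun x hx => norm_le_of_mem_K (mem_J_iff.1 (hαJ x hx)).1)
    (fun x hx n => ⟨fun h => hJ' x hx (mem_J_of_iterate_mem_J n (h ▸ hαJ x hx)), fun h =>
      hJ' x hx (mem_J_of_iterate_mem_J (k + n) (by
        rw [Function.iterate_add_apply, h, hneg x hx]
        exact hαJ x hx))⟩)
    (h₁.mono fun n hn => ⟨(min_le_left _ _).trans hn.1, hn.2.trans (le_max_left _ _)⟩)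
    (h₂.mono fun n hn => by
      rw [sub_neg_eq_add] at hn
      exact ⟨(min_le_right _ _).trans hn.1, hn.2.trans (le_max_right _ _)⟩)
  obtain ⟨x, hx, hzx⟩ := exists_mem_J_of_forall_mem_K (half_pos hr') (Nat.mul_pos hm hq) hK
    fun 𝓤 h𝓤 p hp => hSpar p <| (hSc.isClosed.mem_iff_infDist_zero hSne).2 <|
      tendsto_nhds_unique (((continuous_infDist_pt S).tendsto p).comp hp) (hconv.mono_left h𝓤)
  exact hJ' x (ball_subset_ball (by linarith) hx) hzx
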